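/- arXiv:2304.03222 — 9 statements merged into one kernel-verified Lean document; each statement's English description precedes it below -/
import Mathlib

section
/- Let f : ℝⁿ → ℝ, x⁰ ∈ ℝⁿ, S = [s¹ … s^m] ∈ ℝ^{n×m} and T̄ ∈ ℝ^{n×k}, and take T_1 = T_2 = ⋯ = T_m = T̄. Then, with no rank assumptions on S or T̄, Proj_{S,T̄} ∇²_s f(x⁰;S,T̄) = ∇²_s f(x⁰;S,T̄) and Proj_{S,T̄} ∇²_c f(x⁰;S,T̄) = ∇²_c f(x⁰;S,T̄), where Proj_{S,T̄} H = (Sᵀ)† Sᵀ H T̄ T̄†. -/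
open Matrix

noncomputable section

/-- `B` is the Moore–Penrose pseudoinverse of `A`: the four Penrose equations hold. -/
def IsMPInv {α β : Type*} [Fintype α] [Fintype β]
    (A : Matrix α β ℝ) (B : Matrix β α ℝ) : Prop :=
  A * B * A = A ∧ B * A * B = B ∧ (A * B)ᵀ = A * B ∧ (B * A)ᵀ = B * A

/-- the `j`-th column of a matrix, as a vector -/
def mcol {n m : Type*} (S : Matrix n m ℝ) (j : m) : n → ℝ := fun i => S i j

/-- `δ_s(x⁰;S)`, the vector of forward differences of `f` along the columns of `S` -/
def deltas {n m : Type*} (f : (n → ℝ) → ℝ) (x0 : n → ℝ) (S : Matrix n m ℝ) : m → ℝ :=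
  fun j => f (x0 + mcol S j) - f x0

/-- the generalized simplex gradient `∇_s f(x⁰;S) = (Sᵀ)† δ_s(x⁰;S)`;
here `Sp` stands for the pseudoinverse `(Sᵀ)†`. -/
def gsg {n m : Type*} [Fintype m] (f : (n → ℝ) → ℝ) (x0 : n → ℝ)
    (S Sp : Matrix n m ℝ) : n → ℝ :=
  Sp *ᵥ deltas f x0 S

/-- `δ²_s(x⁰;S,T_{1:m})`, whose `i`-th row is `(∇_s f(x⁰+s^i;T_i) − ∇_s f(x⁰;T_i))ᵀ`;
here `Tp i` stands for the pseudoinverse `((T i)ᵀ)†`. -/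
def delta2s {n m : Type*} {κ : m → Type*} [∀ i, Fintype (κ i)]
    (f : (n → ℝ) → ℝ) (x0 : n → ℝ) (S : Matrix n m ℝ)
    (T Tp : ∀ i, Matrix n (κ i) ℝ) : Matrix m n ℝ :=
  Matrix.of fun i j => gsg f (x0 + mcol S i) (T i) (Tp i) j - gsg f x0 (T i) (Tp i) j

/-- the generalized simplex Hessian `∇²_s f(x⁰;S,T_{1:m}) = (Sᵀ)† δ²_s(x⁰;S,T_{1:m})`;
here `Sp` stands for `(Sᵀ)†` and `Tp i` for `((T i)ᵀ)†`. -/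
def gsh {n m : Type*} [Fintype m] {κ : m → Type*} [∀ i, Fintype (κ i)]
    (f : (n → ℝ) → ℝ) (x0 : n → ℝ) (S Sp : Matrix n m ℝ)
    (T Tp : ∀ i, Matrix n (κ i) ℝ) : Matrix n n ℝ :=
  Sp * delta2s f x0 S T Tp

/-- the generalized centered simplex Hessian
`∇²_c f(x⁰;S,T_{1:m}) = ½(∇²_s f(x⁰;S,T_{1:m}) + ∇²_s f(x⁰;−S,−T_{1:m}))`,
using that `−A†` is the pseudoinverse of `−A`. -/
def gcsh {n m : Type*} [Fintype m] {κ : m → Type*} [∀ i, Fintype (κ i)]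
    (f : (n → ℝ) → ℝ) (x0 : n → ℝ) (S Sp : Matrix n m ℝ)
    (T Tp : ∀ i, Matrix n (κ i) ℝ) : Matrix n n ℝ :=
  (2⁻¹ : ℝ) • (gsh f x0 S Sp T Tp + gsh f x0 (-S) (-Sp) (fun i => -T i) (fun i => -Tp i))

/-- The range of `(Tᵀ)†` lies in the range of `T`, on which `T T†` is the orthogonal projector. -/
theorem transpose_mul_mul_eq_of_isMPInv {α β : Type*} [Fintype α] [Fintype β]
    {T Tp : Matrix α β ℝ} {Td : Matrix β α ℝ} (hTp : IsMPInv Tᵀ Tp) (hTd : IsMPInv T Td) :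
    Tpᵀ * (T * Td) = Tpᵀ := by
  obtain ⟨-, hTp₂, -, hTp₄⟩ := hTp
  obtain ⟨hTd₁, -, hTd₃, -⟩ := hTd
  have hfac : Tp = T * Tpᵀ * Tp := by
    rw [transpose_mul, transpose_transpose] at hTp₄
    rw [hTp₄, hTp₂]
  have hproj : T * Td * Tp = Tp := by
    calc T * Td * Tp = T * Td * T * Tpᵀ * Tp := by
          conv_lhs => rw [hfac]
          simp only [Matrix.mul_assoc]
      _ = Tp := by rw [hTd₁, ← hfac]
  rw [← hTd₃, ← transpose_mul, hproj]

/-- With a common `T`, the rows of `δ²_s` are combinations of the rows of `((Tᵀ)†)ᵀ`. -/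
theorem delta2s_const_eq_mul {n m κ : Type*} [Fintype κ]
    (f : (n → ℝ) → ℝ) (x0 : n → ℝ) (S : Matrix n m ℝ) (T Tp : Matrix n κ ℝ) :
    delta2s f x0 S (fun _ => T) (fun _ => Tp) =
      Matrix.of (fun i => deltas f (x0 + mcol S i) T - deltas f x0 T) * Tpᵀ := by
  ext i j
  simp [delta2s, gsg, Matrix.mul_apply, Matrix.mulVec, dotProduct,
    ← Finset.sum_sub_distrib, ← mul_sub, mul_comm]

theorem mul_gsh_mul_eq_self {n m κ : Type*} [Fintype n] [Fintype m] [Fintype κ]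
    (f : (n → ℝ) → ℝ) (x0 : n → ℝ) (S : Matrix n m ℝ) {Sp : Matrix n m ℝ}
    (T : Matrix n κ ℝ) {Tp : Matrix n κ ℝ} {L R : Matrix n n ℝ}
    (hL : L * Sp = Sp) (hR : Tpᵀ * R = Tpᵀ) :
    L * gsh f x0 S Sp (fun _ => T) (fun _ => Tp) * R =
      gsh f x0 S Sp (fun _ => T) (fun _ => Tp) := by
  rw [gsh, delta2s_const_eq_mul, ← Matrix.mul_assoc L, hL, Matrix.mul_assoc Sp,
    Matrix.mul_assoc _ Tpᵀ, hR]

theorem proj_gsh_eq_of_commonT {n m k : ℕ}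
    (f : (Fin n → ℝ) → ℝ) (x0 : Fin n → ℝ)
    (S Sp : Matrix (Fin n) (Fin m) ℝ)
    (T Tp : Matrix (Fin n) (Fin k) ℝ)
    (Td : Matrix (Fin k) (Fin n) ℝ)
    (hSp : IsMPInv Sᵀ Sp)
    (hTp : IsMPInv Tᵀ Tp)
    (hTd : IsMPInv T Td) :
    Sp * Sᵀ * gsh f x0 S Sp (fun _ => T) (fun _ => Tp) * T * Td
        = gsh f x0 S Sp (fun _ => T) (fun _ => Tp) ∧
      Sp * Sᵀ * gcsh f x0 S Sp (fun _ => T) (fun _ => Tp) * T * Td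
        = gcsh f x0 S Sp (fun _ => T) (fun _ => Tp) := by
  have hP : Tpᵀ * (T * Td) = Tpᵀ := transpose_mul_mul_eq_of_isMPInv hTp hTd
  have hN : (-Tp)ᵀ * (T * Td) = (-Tp)ᵀ := by rw [transpose_neg, Matrix.neg_mul, hP]
  have hL : Sp * Sᵀ * Sp = Sp := hSp.2.1
  have hLN : Sp * Sᵀ * -Sp = -Sp := by rw [Matrix.mul_neg, hL]
  have h₁ := mul_gsh_mul_eq_self f x0 S T hL hP
  have h₂ := mul_gsh_mul_eq_self f x0 (-S) (-T) hLN hN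
  refine ⟨by rw [Matrix.mul_assoc _ T, h₁], ?_⟩
  rw [Matrix.mul_assoc _ T]
  simp only [gcsh, Matrix.mul_smul, Matrix.smul_mul, Matrix.mul_add, Matrix.add_mul, h₁, h₂]
end
end

section
/- Let S = [s¹ … s^m] ∈ ℝ^{n×m} be nonzero with radius Δ_S = max_j ‖s^j‖ > 0 and Ŝ = S/Δ_S. Let Δ̄ > Δ_S, let x⁰ ∈ ℝⁿ, and let f : ℝⁿ → ℝ be twice continuously differentiable on the open ball B(x⁰,Δ̄), with ∇f Lipschitz continuous with constant L_{∇f} ≥ 0 on the closed ball B̄(x⁰,Δ_S). Then ‖Proj_S ∇_s f(x⁰;S) − Proj_S ∇f(x⁰)‖ = ‖∇_s f(x⁰;S) − Proj_S ∇f(x⁰)‖ ≤ (√m/2) · L_{∇f} · ‖(Ŝᵀ)†‖ · Δ_S, where Proj_S v = (Sᵀ)† Sᵀ v. -/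
open Matrix

noncomputable section

/-- the Euclidean norm on `ℝ^n` -/
def vnorm {n : Type*} [Fintype n] (x : n → ℝ) : ℝ := Real.sqrt (∑ i, (x i) ^ 2)

/-- the open Euclidean ball -/
def vball {n : Type*} [Fintype n] (x : n → ℝ) (r : ℝ) : Set (n → ℝ) := {y | vnorm (y - x) < r}

/-- the closed Euclidean ball -/
def vcball {n : Type*} [Fintype n] (x : n → ℝ) (r : ℝ) : Set (n → ℝ) := {y | vnorm (y - x) ≤ r}

/-- the operator 2-norm of a matrix -/
def opNorm {p q : Type*} [Fintype p] [Fintype q] (A : Matrix p q ℝ) : ℝ :=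
  sSup {c | ∃ x : q → ℝ, vnorm x = 1 ∧ c = vnorm (A *ᵥ x)}

/-- the radius of a matrix: the largest Euclidean norm of a column -/
def mradius {n m : Type*} [Fintype n] (S : Matrix n m ℝ) : ℝ := ⨆ j, vnorm (mcol S j)

/-- the gradient of `f` at `x` -/
def grad {n : Type*} [Fintype n] [DecidableEq n] (f : (n → ℝ) → ℝ) (x : n → ℝ) : n → ℝ :=
  fun i => fderiv ℝ f x (Pi.single i 1)

section EuclideanNorm

variable {n m : Type*} [Fintype n] [Fintype m]

lemma vnorm_eq_norm_toLp (x : n → ℝ) : vnorm x = ‖WithLp.toLp 2 x‖ := by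
  simp [vnorm, EuclideanSpace.norm_eq]

lemma vnorm_nonneg (x : n → ℝ) : 0 ≤ vnorm x := Real.sqrt_nonneg _

lemma vnorm_smul (c : ℝ) (x : n → ℝ) : vnorm (c • x) = |c| * vnorm x := by
  simp only [vnorm_eq_norm_toLp, WithLp.toLp_smul, norm_smul, Real.norm_eq_abs]

lemma vnorm_zero : vnorm (0 : n → ℝ) = 0 := by simp [vnorm]

lemma eq_zero_of_vnorm_eq_zero {x : n → ℝ} (h : vnorm x = 0) : x = 0 := by
  rw [vnorm_eq_norm_toLp, norm_eq_zero] at h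
  simpa using congrArg WithLp.ofLp h

lemma continuous_vnorm : Continuous (vnorm : (n → ℝ) → ℝ) := by
  unfold vnorm
  fun_prop

lemma isOpen_vball (x : n → ℝ) (r : ℝ) : IsOpen (vball x r) :=
  isOpen_lt (continuous_vnorm.comp (continuous_id.sub continuous_const)) continuous_const

lemma abs_dotProduct_le_vnorm_mul_vnorm (x y : n → ℝ) : |x ⬝ᵥ y| ≤ vnorm x * vnorm y := by
  have h := abs_real_inner_le_norm (WithLp.toLp 2 y) (WithLp.toLp 2 x)
  rw [EuclideanSpace.inner_toLp_toLp, star_trivial] at h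
  rw [vnorm_eq_norm_toLp, vnorm_eq_norm_toLp, mul_comm]
  exact h

lemma vnorm_le_sqrt_card_mul {x : n → ℝ} {c : ℝ} (hc : 0 ≤ c) (h : ∀ i, |x i| ≤ c) :
    vnorm x ≤ Real.sqrt (Fintype.card n) * c := by
  rw [vnorm, Real.sqrt_le_left (by positivity), mul_pow, Real.sq_sqrt (by positivity)]
  calc ∑ i, x i ^ 2 ≤ ∑ _i : n, c ^ 2 :=
        Finset.sum_le_sum fun i _ => sq_le_sq' (abs_le.mp (h i)).1 (abs_le.mp (h i)).2
    _ = Fintype.card n * c ^ 2 := by simp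

lemma vnorm_mulVec_le_opNorm_mul (A : Matrix n m ℝ) (x : m → ℝ) :
    vnorm (A *ᵥ x) ≤ opNorm A * vnorm x := by
  classical
  have hbdd : BddAbove {c | ∃ x : m → ℝ, vnorm x = 1 ∧ c = vnorm (A *ᵥ x)} := by
    refine ⟨‖A.toEuclideanLin.toContinuousLinearMap‖, ?_⟩
    rintro _ ⟨y, hy, rfl⟩
    have h := A.toEuclideanLin.toContinuousLinearMap.le_opNorm (WithLp.toLp 2 y)
    rw [← vnorm_eq_norm_toLp y, hy, mul_one] at h
    rw [vnorm_eq_norm_toLp]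
    exact h
  rcases (vnorm_nonneg x).eq_or_lt with hx | hx
  · simp [eq_zero_of_vnorm_eq_zero hx.symm, vnorm_zero]
  · have hunit : vnorm ((vnorm x)⁻¹ • x) = 1 := by
      rw [vnorm_smul, abs_of_pos (inv_pos.mpr hx), inv_mul_cancel₀ hx.ne']
    have h : vnorm (A *ᵥ ((vnorm x)⁻¹ • x)) ≤ opNorm A := le_csSup hbdd ⟨_, hunit, rfl⟩
    rw [mulVec_smul, vnorm_smul, abs_of_pos (inv_pos.mpr hx), inv_mul_le_iff₀ hx] at h
    linarith

lemma vnorm_mcol_le_mradius (S : Matrix n m ℝ) (j : m) : vnorm (mcol S j) ≤ mradius S :=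
  le_ciSup (f := fun j => vnorm (mcol S j)) (Set.finite_range _).bddAbove j

end EuclideanNorm

section MoorePenrose

variable {α β : Type*} [Fintype α] [Fintype β]

/-- The Moore–Penrose pseudoinverse is unique. -/
lemma IsMPInv.unique {A : Matrix α β ℝ} {B C : Matrix β α ℝ}
    (hB : IsMPInv A B) (hC : IsMPInv A C) : B = C := by
  obtain ⟨hB₁, hB₂, hB₃, hB₄⟩ := hB
  obtain ⟨hC₁, hC₂, hC₃, hC₄⟩ := hC
  have hleft : A * B = A * C := by
    calc A * B = (A * C * (A * B)) := by rw [← Matrix.mul_assoc, hC₁]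
      _ = ((A * B) * (A * C))ᵀ := by rw [transpose_mul, hB₃, hC₃]
      _ = A * C := by rw [← Matrix.mul_assoc, hB₁, hC₃]
  have hright : B * A = C * A := by
    calc B * A = (B * A) * (C * A) := by
          rw [Matrix.mul_assoc, ← Matrix.mul_assoc A C A, hC₁]
      _ = ((C * A) * (B * A))ᵀ := by rw [transpose_mul, hB₄, hC₄]
      _ = C * A := by rw [Matrix.mul_assoc, ← Matrix.mul_assoc A B A, hB₁, hC₄]
  calc B = B * A * B := hB₂.symm
    _ = C * (A * B) := by rw [hright, Matrix.mul_assoc]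
    _ = C := by rw [hleft, ← Matrix.mul_assoc, hC₂]

lemma IsMPInv.smul {A : Matrix α β ℝ} {B : Matrix β α ℝ} (h : IsMPInv A B) {c : ℝ}
    (hc : c ≠ 0) : IsMPInv (c • A) (c⁻¹ • B) := by
  obtain ⟨h₁, h₂, h₃, h₄⟩ := h
  refine ⟨?_, ?_, ?_, ?_⟩ <;>
    simp [Matrix.smul_mul, Matrix.mul_smul, smul_smul, hc, h₁, h₂, h₃, h₄, -transpose_mul]

end MoorePenrose

section Taylor

variable {n : Type*} [Fintype n] [DecidableEq n]

lemma fderiv_eq_dotProduct_grad (f : (n → ℝ) → ℝ) (x v : n → ℝ) :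
    fderiv ℝ f x v = v ⬝ᵥ grad f x := by
  conv_lhs => rw [pi_eq_sum_univ' v]
  simp only [map_sum, map_smul, dotProduct, grad, smul_eq_mul]

/-- First-order Taylor bound for a function whose gradient grows at most linearly, with slope `L`,
along the segment from `x` to `x + s`. -/
lemma abs_sub_sub_dotProduct_grad_le {f : (n → ℝ) → ℝ} {x s : n → ℝ} {L : ℝ}
    (hf : ∀ t ∈ Set.Icc (0 : ℝ) 1, DifferentiableAt ℝ f (x + t • s))
    (hL : ∀ t ∈ Set.Icc (0 : ℝ) 1, vnorm (grad f (x + t • s) - grad f x) ≤ L * vnorm (t • s)) :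
    |f (x + s) - f x - s ⬝ᵥ grad f x| ≤ L / 2 * vnorm s ^ 2 := by
  have hderiv : ∀ t ∈ Set.Icc (0 : ℝ) 1,
      HasDerivAt (fun t : ℝ => f (x + t • s) - f x - t * (s ⬝ᵥ grad f x))
        (s ⬝ᵥ (grad f (x + t • s) - grad f x)) t := by
    intro t ht
    have hline : HasDerivAt (fun t : ℝ => x + t • s) s t := by
      simpa using ((hasDerivAt_id t).smul_const s).const_add x
    have h := (((hf t ht).hasFDerivAt.comp_hasDerivAt t hline).sub_const (f x)).sub
      ((hasDerivAt_id t).mul_const (s ⬝ᵥ grad f x))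
    rw [fderiv_eq_dotProduct_grad, one_mul, ← dotProduct_sub] at h
    exact h
  have hbound : ∀ t : ℝ, HasDerivAt (fun t : ℝ => L / 2 * vnorm s ^ 2 * t ^ 2)
      (L * vnorm s ^ 2 * t) t := by
    intro t
    convert! (hasDerivAt_pow 2 t).const_mul (L / 2 * vnorm s ^ 2) using 1
    push_cast
    ring
  have h := image_norm_le_of_norm_deriv_right_le_deriv_boundary (a := 0) (b := 1)
    (fun t ht => (hderiv t ht).continuousAt.continuousWithinAt)
    (fun t ht => (hderiv t (Set.Ico_subset_Icc_self ht)).hasDerivWithinAt) (by simp) hbound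
    (fun t ht => by
      have ht' := Set.Ico_subset_Icc_self ht
      have hgrad := hL t ht'
      rw [vnorm_smul, abs_of_nonneg ht.1] at hgrad
      calc ‖s ⬝ᵥ (grad f (x + t • s) - grad f x)‖
          ≤ vnorm s * vnorm (grad f (x + t • s) - grad f x) :=
            abs_dotProduct_le_vnorm_mul_vnorm _ _
        _ ≤ vnorm s * (L * (t * vnorm s)) :=
            mul_le_mul_of_nonneg_left hgrad (vnorm_nonneg s)
        _ = L * vnorm s ^ 2 * t := by ring)
    (Set.right_mem_Icc.mpr zero_le_one)
  simpa using h

end Taylor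

theorem gsg_error_bound {n m : ℕ}
    (f : (Fin n → ℝ) → ℝ) (x0 : Fin n → ℝ)
    (S Sp Shp : Matrix (Fin n) (Fin m) ℝ)
    (Δbar L : ℝ)
    (hSp : IsMPInv Sᵀ Sp)
    (hShp : IsMPInv ((mradius S)⁻¹ • S)ᵀ Shp)
    (hΔS : 0 < mradius S)
    (hΔbar : mradius S < Δbar)
    (hf : ContDiffOn ℝ 2 f (vball x0 Δbar))
    (hL : 0 ≤ L)
    (hlip : ∀ x ∈ vcball x0 (mradius S), ∀ y ∈ vcball x0 (mradius S),
      vnorm (grad f x - grad f y) ≤ L * vnorm (x - y)) :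
    vnorm (Sp *ᵥ (Sᵀ *ᵥ gsg f x0 S Sp) - Sp *ᵥ (Sᵀ *ᵥ grad f x0))
        = vnorm (gsg f x0 S Sp - Sp *ᵥ (Sᵀ *ᵥ grad f x0)) ∧
      vnorm (gsg f x0 S Sp - Sp *ᵥ (Sᵀ *ᵥ grad f x0))
        ≤ Real.sqrt m / 2 * L * opNorm Shp * mradius S := by
  have hres : gsg f x0 S Sp - Sp *ᵥ (Sᵀ *ᵥ grad f x0)
      = Sp *ᵥ (deltas f x0 S - Sᵀ *ᵥ grad f x0) := by
    rw [gsg, mulVec_sub]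
  have hproj : Sp *ᵥ (Sᵀ *ᵥ gsg f x0 S Sp) = gsg f x0 S Sp := by
    rw [gsg, mulVec_mulVec, mulVec_mulVec, hSp.2.1]
  refine ⟨by rw [hproj], ?_⟩
  have hShp_eq : Shp = mradius S • Sp := by
    have h := hSp.smul (inv_ne_zero hΔS.ne')
    rw [inv_inv, ← transpose_smul] at h
    exact hShp.unique h
  have hSp_eq : Sp = (mradius S)⁻¹ • Shp := by
    rw [hShp_eq, smul_smul, inv_mul_cancel₀ hΔS.ne', one_smul]
  have hcomp : ∀ j, |(deltas f x0 S - Sᵀ *ᵥ grad f x0) j| ≤ L / 2 * mradius S ^ 2 := by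
    intro j
    have hs := vnorm_mcol_le_mradius S j
    have hmem : ∀ t ∈ Set.Icc (0 : ℝ) 1, vnorm (x0 + t • mcol S j - x0) ≤ mradius S := by
      intro t ht
      rw [add_sub_cancel_left, vnorm_smul, abs_of_nonneg ht.1]
      exact (mul_le_of_le_one_left (vnorm_nonneg _) ht.2).trans hs
    have htaylor := abs_sub_sub_dotProduct_grad_le (f := f) (x := x0) (s := mcol S j) (L := L)
      (fun t ht => (hf.differentiableOn two_ne_zero).differentiableAt
        ((isOpen_vball x0 Δbar).mem_nhds ((hmem t ht).trans_lt hΔbar)))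
      (fun t ht => by
        have hx0 : x0 ∈ vcball x0 (mradius S) := by
          simp [vcball, vnorm_zero, hΔS.le]
        simpa only [add_sub_cancel_left] using hlip _ (hmem t ht) _ hx0)
    refine htaylor.trans ?_
    have := vnorm_nonneg (mcol S j)
    gcongr
  have hvec := vnorm_le_sqrt_card_mul (by positivity) hcomp
  rw [Fintype.card_fin] at hvec
  have hop : 0 ≤ opNorm Shp :=
    Real.sSup_nonneg (by rintro _ ⟨y, -, rfl⟩; exact vnorm_nonneg _)
  rw [hres, hSp_eq, smul_mulVec, vnorm_smul, abs_of_pos (inv_pos.mpr hΔS), inv_mul_le_iff₀ hΔS]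
  calc vnorm (Shp *ᵥ (deltas f x0 S - Sᵀ *ᵥ grad f x0))
      ≤ opNorm Shp * vnorm (deltas f x0 S - Sᵀ *ᵥ grad f x0) := vnorm_mulVec_le_opNorm_mul _ _
    _ ≤ opNorm Shp * (Real.sqrt m * (L / 2 * mradius S ^ 2)) :=
        mul_le_mul_of_nonneg_left hvec hop
    _ = mradius S * (Real.sqrt m / 2 * L * opNorm Shp * mradius S) := by ring
end
end

section
/- Let f : ℝⁿ → ℝ, x⁰ ∈ ℝⁿ, S = [s¹ … s^m] ∈ ℝ^{n×m} and T̄ = [t¹ … t^k] ∈ ℝ^{n×k}, and use T̄ as the common inner matrix for all columns of S. Then the transpose of the generalized simplex Hessian of f at x⁰ over S and T̄ equals the generalized simplex Hessian of f at x⁰ over T̄ and S: (∇²_s f(x⁰;S,T̄))ᵀ = ∇²_s f(x⁰;T̄,S), where ∇²_s f(x⁰;T̄,S) = (T̄ᵀ)† δ²_s(x⁰;T̄,S) with δ²_s(x⁰;T̄,S) ∈ ℝ^{k×n} having j-th row (∇_s f(x⁰+t^j;S) − ∇_s f(x⁰;S))ᵀ. -/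
open Matrix

noncomputable section

/-- The second-order forward differences of `f` along the columns of `S` and `T`. -/
def secondDiff {n m k : Type*} (f : (n → ℝ) → ℝ) (x0 : n → ℝ)
    (S : Matrix n m ℝ) (T : Matrix n k ℝ) : Matrix m k ℝ :=
  Matrix.of fun i j =>
    f (x0 + mcol S i + mcol T j) - f (x0 + mcol S i) - (f (x0 + mcol T j) - f x0)

theorem transpose_secondDiff {n m k : Type*} (f : (n → ℝ) → ℝ) (x0 : n → ℝ)
    (S : Matrix n m ℝ) (T : Matrix n k ℝ) :
    (secondDiff f x0 S T)ᵀ = secondDiff f x0 T S := by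
  ext j i
  simp only [secondDiff, transpose_apply, of_apply, add_right_comm x0 (mcol S i) (mcol T j)]
  ring

/-- With a common inner matrix, the generalized simplex Hessian is a two-sided product. -/
theorem gsh_const {n m k : Type*} [Fintype m] [Fintype k] (f : (n → ℝ) → ℝ) (x0 : n → ℝ)
    (S Sp : Matrix n m ℝ) (T Tp : Matrix n k ℝ) :
    gsh f x0 S Sp (fun _ : m => T) (fun _ => Tp) = Sp * (secondDiff f x0 S T * Tpᵀ) := by
  unfold gsh
  congr 1
  ext i j
  simp only [delta2s, gsg, deltas, secondDiff, of_apply, mul_apply, mulVec, dotProduct,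
    transpose_apply, ← Finset.sum_sub_distrib]
  exact Finset.sum_congr rfl fun _ _ => by ring

theorem gsh_transpose {n m k : ℕ}
    (f : (Fin n → ℝ) → ℝ) (x0 : Fin n → ℝ)
    (S Sp : Matrix (Fin n) (Fin m) ℝ)
    (T Tp : Matrix (Fin n) (Fin k) ℝ)
    (hSp : IsMPInv Sᵀ Sp)
    (hTp : IsMPInv Tᵀ Tp) :
    (gsh f x0 S Sp (fun _ : Fin m => T) (fun _ => Tp))ᵀ
      = gsh f x0 T Tp (fun _ : Fin k => S) (fun _ => Sp) := by
  simp only [gsh_const, transpose_mul, transpose_transpose, transpose_secondDiff, Matrix.mul_assoc]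
end
end

section
/- Let x⁰ ∈ ℝⁿ and S = [s¹ … sⁿ] ∈ ℝ^{n×n}. For every ℓ ∈ {0,1,…,n}, the set for GSH computation 𝒮(x⁰;S,U_ℓ) contains at most (n+1)(n+2)/2 distinct points. -/
open Matrix

noncomputable section

/-- the set of all points used in the computation of the generalized simplex Hessian
`∇²_s f(x⁰;S,T̄)` -/
def gshSet {n m k : ℕ} (x0 : Fin n → ℝ) (S : Matrix (Fin n) (Fin m) ℝ)
    (T : Matrix (Fin n) (Fin k) ℝ) : Set (Fin n → ℝ) :=
  {x0} ∪ (Set.range fun i => x0 + mcol S i) ∪ (Set.range fun j => x0 + mcol T j)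
    ∪ (Set.range fun p : Fin m × Fin k => x0 + mcol S p.1 + mcol T p.2)

/-- the matrices `U_ℓ`, `ℓ ∈ {0,1,…,n}`: `U₀ = S` (encoded by `none`) and, for
`ℓ ∈ {1,…,n}` (encoded by `some l`), the `ℓ`-th column of `U_ℓ` is `−s^ℓ` and its
`j`-th column is `s^j − s^ℓ` for `j ≠ ℓ`. -/
def Umat {n : ℕ} (S : Matrix (Fin n) (Fin n) ℝ) : Option (Fin n) → Matrix (Fin n) (Fin n) ℝ
  | none => S
  | some l => Matrix.of fun i j => if j = l then -S i l else S i j - S i l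

/-- the columns of `S` together with the zero vector, indexed by `none` -/
def augCol {n m : ℕ} (S : Matrix (Fin n) (Fin m) ℝ) (a : Option (Fin m)) : Fin n → ℝ :=
  a.elim 0 (mcol S)

/-- the point `x⁰ + a + b - c` for an unordered pair `{a, b}` of augmented columns of `S` and
a fixed augmented column `c` -/
def pairPoint {n m : ℕ} (x0 : Fin n → ℝ) (S : Matrix (Fin n) (Fin m) ℝ) (ℓ : Option (Fin m)) :
    Sym2 (Option (Fin m)) → (Fin n → ℝ) :=
  Sym2.lift ⟨fun a b => x0 + augCol S a + augCol S b - augCol S ℓ,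
    fun a b => by simp only [add_right_comm]⟩

theorem exists_mcol_Umat_eq {n : ℕ} (S : Matrix (Fin n) (Fin n) ℝ) (ℓ : Option (Fin n))
    (j : Fin n) : ∃ b, mcol (Umat S ℓ) j = augCol S b - augCol S ℓ := by
  cases ℓ with
  | none => exact ⟨some j, by simp [Umat, augCol]⟩
  | some l =>
    by_cases h : j = l
    · exact ⟨none, by ext i; simp [Umat, augCol, mcol, h]⟩
    · exact ⟨some j, by ext i; simp [Umat, augCol, mcol, h]⟩

theorem gshSet_subset_range_pairPoint {n : ℕ} (x0 : Fin n → ℝ) (S : Matrix (Fin n) (Fin n) ℝ)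
    (ℓ : Option (Fin n)) :
    gshSet x0 S (Umat S ℓ) ⊆ Set.range (pairPoint x0 S ℓ) := by
  rintro _ (((rfl | ⟨i, rfl⟩) | ⟨j, rfl⟩) | ⟨⟨i, j⟩, rfl⟩)
  · exact ⟨s(none, ℓ), by simp [pairPoint, augCol]⟩
  · exact ⟨s(some i, ℓ), by simp [pairPoint, augCol]⟩
  · obtain ⟨b, hb⟩ := exists_mcol_Umat_eq S ℓ j
    exact ⟨s(none, b), by simp [pairPoint, hb, augCol, add_sub_assoc]⟩
  · obtain ⟨b, hb⟩ := exists_mcol_Umat_eq S ℓ j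
    exact ⟨s(some i, b), by simp [pairPoint, hb, augCol, add_sub_assoc]⟩

theorem gshSet_card_le {n : ℕ} (x0 : Fin n → ℝ) (S : Matrix (Fin n) (Fin n) ℝ)
    (ℓ : Option (Fin n)) :
    (gshSet x0 S (Umat S ℓ)).ncard ≤ (n + 1) * (n + 2) / 2 := by
  calc (gshSet x0 S (Umat S ℓ)).ncard
      ≤ (Set.range (pairPoint x0 S ℓ)).ncard :=
        Set.ncard_le_ncard (gshSet_subset_range_pairPoint x0 S ℓ) (Set.finite_range _)
    _ ≤ Nat.card (Sym2 (Option (Fin n))) := Finite.card_range_le _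
    _ = (n + 1) * (n + 2) / 2 := by
        rw [Nat.card_eq_fintype_card, Sym2.card, Nat.choose_two_right]
        simp [mul_comm]
end
end

section
/- Let x⁰ ∈ ℝⁿ and let S = [s¹ … sⁿ] ∈ ℝ^{n×n} have rank n. Then for every ℓ ∈ {0,1,…,n}, the set for GSH computation 𝒮(x⁰;S,U_ℓ) contains exactly (n+1)(n+2)/2 distinct points. -/
open Matrix

noncomputable section

/-- The columns of `S` extended by the zero vector at `none`. -/
def extCol {n : ℕ} (S : Matrix (Fin n) (Fin n) ℝ) (a : Option (Fin n)) : Fin n → ℝ :=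
  a.elim 0 (mcol S)

theorem extCol_eq_mulVec {n : ℕ} (S : Matrix (Fin n) (Fin n) ℝ) (a : Option (Fin n)) :
    extCol S a = S *ᵥ fun i => if a = some i then 1 else 0 := by
  cases a <;> ext <;> simp [extCol, mcol, Matrix.mulVec, dotProduct]

theorem mulVec_injective_of_rank_eq {n : ℕ} {S : Matrix (Fin n) (Fin n) ℝ} (hS : S.rank = n) :
    Function.Injective S.mulVec := by
  have hrange : LinearMap.range S.mulVecLin = ⊤ :=
    Submodule.eq_top_of_finrank_eq (by rw [← Matrix.rank, hS, Module.finrank_fin_fun])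
  exact LinearMap.injective_iff_surjective.mpr (LinearMap.range_eq_top.mp hrange)

/-- The sum of two extended columns, as a function of the unordered pair of indices. -/
def extColPairSum {n : ℕ} (S : Matrix (Fin n) (Fin n) ℝ) : Sym2 (Option (Fin n)) → Fin n → ℝ :=
  Sym2.lift ⟨fun a b => extCol S a + extCol S b, fun _ _ => add_comm _ _⟩

theorem extColPairSum_injective {n : ℕ} {S : Matrix (Fin n) (Fin n) ℝ} (hS : S.rank = n) :
    Function.Injective (extColPairSum S) := by
  intro p q
  induction p with | _ a b
  induction q with | _ c d
  intro h
  simp only [extColPairSum, Sym2.lift_mk, extCol_eq_mulVec, ← Matrix.mulVec_add] at h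
  have hcoord (o : Option (Fin n)) (ho : o ≠ none) :
      ((if a = o then 1 else 0) + (if b = o then 1 else 0) : ℝ) =
        (if c = o then 1 else 0) + (if d = o then 1 else 0) := by
    obtain ⟨i, rfl⟩ := Option.ne_none_iff_exists'.mp ho
    exact congrFun (mulVec_injective_of_rank_eq hS h) i
  have ha := hcoord a
  have hb := hcoord b
  have hc := hcoord c
  have hd := hcoord d
  clear h hcoord
  rw [Sym2.eq_iff]
  by_cases a = none <;> by_cases b = none <;> by_cases c = none <;> by_cases d = none <;> grind

theorem gshSet_eq_range {n : ℕ} (x0 : Fin n → ℝ) (S T : Matrix (Fin n) (Fin n) ℝ) :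
    gshSet x0 S T =
      Set.range fun p : Option (Fin n) × Option (Fin n) => x0 + extCol S p.1 + extCol T p.2 := by
  ext x
  simp only [gshSet, Set.mem_union, Set.mem_singleton_iff, Set.mem_range, Prod.exists,
    Option.exists, extCol, Option.elim_none, Option.elim_some, add_zero, eq_comm (a := x), exists_or]
  tauto

/-- The extended columns of `U_ℓ` are the differences `v b - v ℓ` of extended columns `v` of `S`:
exchanging the indices `none` and `ℓ` matches them up. -/
theorem extCol_Umat {n : ℕ} (S : Matrix (Fin n) (Fin n) ℝ) (ℓ b : Option (Fin n)) :
    extCol (Umat S ℓ) b = extCol S (Equiv.swap none ℓ b) - extCol S ℓ := by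
  cases ℓ with
  | none => simp [extCol, Umat]
  | some l =>
    cases b with
    | none => simp [extCol]
    | some j =>
      by_cases hj : j = l
      · ext i
        simp [extCol, Umat, mcol, hj]
      · rw [Equiv.swap_apply_of_ne_of_ne (by simp) (by simpa using hj)]
        ext i
        simp [extCol, Umat, mcol, hj]

theorem gshSet_Umat_eq_range {n : ℕ} (x0 : Fin n → ℝ) (S : Matrix (Fin n) (Fin n) ℝ)
    (ℓ : Option (Fin n)) :
    gshSet x0 S (Umat S ℓ) = Set.range fun p => x0 - extCol S ℓ + extColPairSum S p := by
  rw [gshSet_eq_range]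
  ext x
  simp only [Set.mem_range, Prod.exists, Sym2.exists, extCol_Umat]
  refine exists_congr fun a => (Equiv.swap none ℓ).exists_congr fun b => ?_
  have hsum : x0 + extCol S a + (extCol S (Equiv.swap none ℓ b) - extCol S ℓ) =
      x0 - extCol S ℓ + (extCol S a + extCol S (Equiv.swap none ℓ b)) := by abel
  rw [hsum]
  rfl

theorem gshSet_card_eq_of_rank {n : ℕ} (x0 : Fin n → ℝ) (S : Matrix (Fin n) (Fin n) ℝ)
    (hS : S.rank = n) (ℓ : Option (Fin n)) :
    (gshSet x0 S (Umat S ℓ)).ncard = (n + 1) * (n + 2) / 2 := by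
  have hinj : Function.Injective fun p => x0 - extCol S ℓ + extColPairSum S p :=
    (add_right_injective _).comp (extColPairSum_injective hS)
  rw [gshSet_Umat_eq_range, Set.ncard_range_of_injective hinj, Sym2.natCard,
    Nat.card_eq_fintype_card, Fintype.card_option, Fintype.card_fin,
    Nat.choose_two_right, mul_comm]
  rfl
end
end

section
/- Let x⁰ ∈ ℝⁿ, let S, T̄ ∈ ℝ^{n×n}, let N ∈ ℝ^{n×n} be invertible, and let P₁, P₂ ∈ ℝ^{n×n} be permutation matrices. Then 𝒮(x⁰;S,T̄) is a minimal poised set for the GSH at x⁰ if and only if 𝒮(x⁰;N S P₁, N T̄ P₂) is a minimal poised set for the GSH at x⁰. -/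
open Matrix

noncomputable section

/-- `𝒮(x⁰;S,T̄)` is a minimal poised set for the GSH at `x⁰` -/
def IsMinimalPoisedGSH {n : ℕ} (x0 : Fin n → ℝ) (S T : Matrix (Fin n) (Fin n) ℝ) : Prop :=
  S.rank = n ∧ T.rank = n ∧ (gshSet x0 S T).ncard = (n + 1) * (n + 2) / 2

theorem mcol_mul_permMatrix {n m : ℕ} (N : Matrix (Fin n) (Fin n) ℝ)
    (S : Matrix (Fin n) (Fin m) ℝ) (σ : Equiv.Perm (Fin m)) (j : Fin m) :
    mcol (N * S * σ.permMatrix ℝ) j = N *ᵥ mcol S (σ.symm j) := by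
  ext i
  rw [mcol, Equiv.Perm.permMatrix, PEquiv.mul_toMatrix_toPEquiv]
  rfl

theorem rank_mul_permMatrix {n m : ℕ} {N : Matrix (Fin n) (Fin n) ℝ} (hN : IsUnit N)
    (S : Matrix (Fin n) (Fin m) ℝ) (σ : Equiv.Perm (Fin m)) :
    (N * S * σ.permMatrix ℝ).rank = S.rank := by
  rw [rank_mul_eq_left_of_isUnit_det, rank_mul_eq_right_of_isUnit_det]
  · exact (isUnit_iff_isUnit_det N).1 hN
  · rw [det_permutation]
    exact (Equiv.Perm.sign σ).isUnit.map (Int.castRingHom ℝ)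

/-- Transforming the direction matrices maps the sample set by an affine map fixing `x0`. -/
theorem gshSet_transform {n m k : ℕ} (x0 : Fin n → ℝ) (S : Matrix (Fin n) (Fin m) ℝ)
    (T : Matrix (Fin n) (Fin k) ℝ) (N : Matrix (Fin n) (Fin n) ℝ)
    (σ₁ : Equiv.Perm (Fin m)) (σ₂ : Equiv.Perm (Fin k)) :
    gshSet x0 (N * S * σ₁.permMatrix ℝ) (N * T * σ₂.permMatrix ℝ) =
      (fun y => x0 + N *ᵥ (y - x0)) '' gshSet x0 S T := by
  simp only [gshSet, mcol_mul_permMatrix, Set.image_union, Set.image_singleton, ← Set.range_comp]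
  congr 1
  · congr 1
    · congr 1
      · simp
      · refine Eq.trans ?_ (σ₁.symm.surjective.range_comp _)
        simp [Function.comp_def]
    · refine Eq.trans ?_ (σ₂.symm.surjective.range_comp _)
      simp [Function.comp_def]
  · refine Eq.trans ?_ ((σ₁.symm.prodCongr σ₂.symm).surjective.range_comp _)
    simp [Function.comp_def, add_assoc, mulVec_add]

theorem isMinimalPoised_iff_transform {n : ℕ} (x0 : Fin n → ℝ)
    (S T N : Matrix (Fin n) (Fin n) ℝ) (hN : IsUnit N)
    (σ₁ σ₂ : Equiv.Perm (Fin n)) :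
    IsMinimalPoisedGSH x0 S T ↔
      IsMinimalPoisedGSH x0 (N * S * σ₁.permMatrix ℝ) (N * T * σ₂.permMatrix ℝ) := by
  have hinj : Function.Injective fun y => x0 + N *ᵥ (y - x0) := fun y z h =>
    sub_left_injective (mulVec_injective_of_isUnit hN (add_left_cancel h))
  rw [IsMinimalPoisedGSH, IsMinimalPoisedGSH, rank_mul_permMatrix hN, rank_mul_permMatrix hN,
    gshSet_transform, Set.ncard_image_of_injective _ hinj]
end
end

section
/- Let x⁰ ∈ ℝⁿ, let S = [s¹ … sⁿ] ∈ ℝ^{n×n} have rank n, and let ℓ ∈ {0,1,…,n}. Then the minimal poised set 𝒮(x⁰;S,U_ℓ) is poised for quadratic interpolation: the only α₀ ∈ ℝ, α ∈ ℝⁿ and symmetric matrix H ∈ ℝ^{n×n} satisfying α₀ + αᵀ y + ½ yᵀ H y = 0 for every y ∈ 𝒮(x⁰;S,U_ℓ) are α₀ = 0, α = 0 and H = 0. -/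
open Matrix

noncomputable section

/-- A symmetric bilinear form and a linear form whose sum `L v + B v v / 2` vanishes on the
displacements of the minimal poised set vanish on the columns of `S`. -/
theorem forms_vanish_on_columns {n : ℕ} (S : Matrix (Fin n) (Fin n) ℝ) (ℓ : Option (Fin n))
    (L : (Fin n → ℝ) →ₗ[ℝ] ℝ) (B : (Fin n → ℝ) →ₗ[ℝ] (Fin n → ℝ) →ₗ[ℝ] ℝ)
    (hB : ∀ v w, B v w = B w v)
    (hs : ∀ i, L (mcol S i) + B (mcol S i) (mcol S i) / 2 = 0)
    (ht : ∀ j, L (mcol (Umat S ℓ) j) + B (mcol (Umat S ℓ) j) (mcol (Umat S ℓ) j) / 2 = 0)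
    (hst : ∀ i j, L (mcol S i + mcol (Umat S ℓ) j) +
      B (mcol S i + mcol (Umat S ℓ) j) (mcol S i + mcol (Umat S ℓ) j) / 2 = 0) :
    (∀ i, L (mcol S i) = 0) ∧ ∀ i j, B (mcol S i) (mcol S j) = 0 := by
  suffices h : ∀ i j, B (mcol S i) (mcol S j) = 0 from
    ⟨fun i => by linarith [hs i, h i i], h⟩
  cases ℓ with
  | none =>
    simp only [Umat, map_add, LinearMap.add_apply] at hst
    intro i j
    linarith [hs i, hs j, hst i j, hB (mcol S i) (mcol S j)]
  | some l =>
    have hl : mcol (Umat S (some l)) l = -mcol S l := by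
      ext i; simp [mcol, Umat]
    have hne : ∀ j, j ≠ l → mcol (Umat S (some l)) j = mcol S j - mcol S l := by
      intro j hj; ext i; simp [mcol, Umat, hj]
    have hll : B (mcol S l) (mcol S l) = 0 := by
      have h := ht l
      simp only [hl, map_neg, LinearMap.neg_apply] at h
      linarith [hs l]
    have hLl : L (mcol S l) = 0 := by linarith [hs l]
    have hjl : ∀ j, B (mcol S j) (mcol S l) = 0 := by
      intro j
      rcases eq_or_ne j l with rfl | hj
      · exact hll
      · have h := ht j
        simp only [hne j hj, map_sub, LinearMap.sub_apply] at h
        linarith [hs j, hB (mcol S j) (mcol S l)]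
    intro i j
    rcases eq_or_ne j l with rfl | hj
    · exact hjl i
    · have h := hst i j
      simp only [hne j hj, map_add, map_sub, LinearMap.add_apply, LinearMap.sub_apply] at h
      linarith [hs i, hs j, hjl i, hjl j, hB (mcol S i) (mcol S j),
        hB (mcol S i) (mcol S l), hB (mcol S j) (mcol S l)]

theorem minimal_poised_set_poised_for_quadratic {n : ℕ} (x0 : Fin n → ℝ)
    (S : Matrix (Fin n) (Fin n) ℝ) (hS : S.rank = n) (ℓ : Option (Fin n))
    (α₀ : ℝ) (α : Fin n → ℝ) (H : Matrix (Fin n) (Fin n) ℝ) (hH : H.IsSymm)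
    (hvanish : ∀ y ∈ gshSet x0 S (Umat S ℓ),
      α₀ + α ⬝ᵥ y + (1 / 2) * (y ⬝ᵥ (H *ᵥ y)) = 0) :
    α₀ = 0 ∧ α = 0 ∧ H = 0 := by
  have hunit : IsUnit S := by
    rw [← Matrix.linearIndependent_rows_iff_isUnit, linearIndependent_iff_card_eq_finrank_span,
      Set.finrank, ← Matrix.rank_eq_finrank_span_row, hS, Fintype.card_fin]
  have hsymm : ∀ v w, v ⬝ᵥ H *ᵥ w = w ⬝ᵥ H *ᵥ v := by
    intro v w
    rw [dotProduct_mulVec, ← mulVec_transpose, hH.eq, dotProduct_comm]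
  have hx0 : α₀ + α ⬝ᵥ x0 + (1 / 2) * (x0 ⬝ᵥ (H *ᵥ x0)) = 0 :=
    hvanish x0 (by simp [gshSet])
  let L : (Fin n → ℝ) →ₗ[ℝ] ℝ := dotProductBilin ℝ ℝ (α + H *ᵥ x0)
  let B : (Fin n → ℝ) →ₗ[ℝ] (Fin n → ℝ) →ₗ[ℝ] ℝ := Matrix.toLinearMap₂' ℝ H
  have hL : ∀ v, L v = (α + H *ᵥ x0) ⬝ᵥ v := fun v => rfl
  have hB : ∀ v w, B v w = v ⬝ᵥ H *ᵥ w := fun v w => Matrix.toLinearMap₂'_apply' H v w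
  have key : ∀ v, x0 + v ∈ gshSet x0 S (Umat S ℓ) → L v + B v v / 2 = 0 := by
    intro v hv
    have h := hvanish _ hv
    simp only [mulVec_add, dotProduct_add, add_dotProduct] at h
    rw [hL, hB, add_dotProduct, dotProduct_comm (H *ᵥ x0) v]
    linarith [hsymm x0 v]
  obtain ⟨hLS, hBS⟩ := forms_vanish_on_columns S ℓ L B
    (fun v w => by rw [hB, hB, hsymm])
    (fun i => key _ (Or.inl (Or.inl (Or.inr ⟨i, rfl⟩))))
    (fun j => key _ (Or.inl (Or.inr ⟨j, rfl⟩)))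
    (fun i j => key _ (Or.inr ⟨(i, j), add_assoc _ _ _⟩))
  have hH0 : H = 0 := by
    have h : Sᵀ * (H * S) = 0 := by
      ext i j
      exact (hB _ _).symm.trans (hBS i j)
    rwa [((isUnit_transpose S).mpr hunit).mul_right_eq_zero, hunit.mul_left_eq_zero] at h
  subst hH0
  have hα : α = 0 := by
    apply Matrix.vecMul_injective_of_isUnit hunit
    ext i
    have h : α ⬝ᵥ mcol S i = 0 := by simpa [hL] using hLS i
    exact h.trans (congrFun (zero_vecMul S) i).symm
  subst hα
  exact ⟨by simpa using hx0, rfl, rfl⟩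
end
end

section
/- Let x⁰ ∈ ℝⁿ, let S = [s¹ … sⁿ] ∈ ℝ^{n×n} be invertible, let ℓ ∈ {1,…,n}, and let f : ℝⁿ → ℝ be defined on 𝒮(x⁰;S,U_ℓ). Define the symmetric matrix Ĥ ∈ ℝ^{n×n} by: Ĥ_{i,ℓ} = Ĥ_{ℓ,i} = −f(x⁰+s^i−s^ℓ) + f(x⁰+s^i) + f(x⁰−s^ℓ) − f(x⁰) for i ≠ ℓ; Ĥ_{i,i} = f(x⁰+2s^i−s^ℓ) − 2f(x⁰+s^i−s^ℓ) + f(x⁰−s^ℓ) for i ≠ ℓ; Ĥ_{ℓ,ℓ} = f(x⁰+s^ℓ) + f(x⁰−s^ℓ) − 2f(x⁰); and Ĥ_{i,j} = f(x⁰+s^i+s^j−s^ℓ) − f(x⁰+s^i−s^ℓ) − f(x⁰+s^j−s^ℓ) + f(x⁰−s^ℓ) for distinct i, j both different from ℓ. Set H = S^{−ᵀ} Ĥ S^{−1}, ᾱ ∈ ℝⁿ with ᾱ_i = f(x⁰+s^i) − f(x⁰) − ½ Ĥ_{i,i} − (x⁰)ᵀ H s^i, α = S^{−ᵀ} ᾱ,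 and α₀ = f(x⁰) − αᵀ x⁰ − ½ (x⁰)ᵀ H x⁰. Then the quadratic Q(x) = α₀ + αᵀ x + ½ xᵀ H x interpolates f on the whole sample set: Q(y) = f(y) for every y ∈ 𝒮(x⁰;S,U_ℓ). -/
open Matrix

noncomputable section

theorem mcol_eq_mulVec_single {n m : Type*} [Fintype m] [DecidableEq m]
    (S : Matrix n m ℝ) (j : m) : mcol S j = S *ᵥ Pi.single j 1 := by
  ext i
  simp [mcol]

theorem mcol_dotProduct_congruence_mulVec_mcol {n : Type*} [Fintype n] [DecidableEq n]
    {S : Matrix n n ℝ} (hS : IsUnit S.det) (A : Matrix n n ℝ) (i j : n) :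
    mcol S i ⬝ᵥ (((Sᵀ)⁻¹ * A * S⁻¹) *ᵥ mcol S j) = A i j := by
  have hT : IsUnit Sᵀ.det := by rwa [det_transpose]
  have h : Sᵀ * ((Sᵀ)⁻¹ * A * S⁻¹) * S = A := by
    rw [Matrix.mul_assoc (Sᵀ)⁻¹, mul_nonsing_inv_cancel_left _ _ hT,
      nonsing_inv_mul_cancel_right _ _ hS]
  rw [mcol_eq_mulVec_single S i, mcol_eq_mulVec_single S j, ← vecMul_transpose,
    ← dotProduct_mulVec, mulVec_mulVec, mulVec_mulVec, h]
  simp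

theorem inv_transpose_mulVec_dotProduct_mcol {n : Type*} [Fintype n] [DecidableEq n]
    {S : Matrix n n ℝ} (hS : IsUnit S.det) (v : n → ℝ) (i : n) :
    ((Sᵀ)⁻¹ *ᵥ v) ⬝ᵥ mcol S i = v i := by
  rw [mcol_eq_mulVec_single, ← transpose_nonsing_inv, mulVec_transpose, ← dotProduct_mulVec,
    mulVec_mulVec, nonsing_inv_mul _ hS, one_mulVec, dotProduct_single_one]

theorem dotProduct_mulVec_comm_of_isSymm {n : Type*} [Fintype n] {A : Matrix n n ℝ}
    (hA : A.IsSymm) (u v : n → ℝ) : u ⬝ᵥ (A *ᵥ v) = v ⬝ᵥ (A *ᵥ u) := by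
  rw [dotProduct_mulVec, ← mulVec_transpose, hA.eq, dotProduct_comm]

theorem mcol_Umat_some {n : ℕ} (S : Matrix (Fin n) (Fin n) ℝ) (l j : Fin n) :
    mcol (Umat S (some l)) j = if j = l then -mcol S l else mcol S j - mcol S l := by
  ext i
  by_cases h : j = l <;> simp [mcol, Umat, h]

theorem quad_interp_coeffs {n : ℕ} (x0 : Fin n → ℝ)
    (S : Matrix (Fin n) (Fin n) ℝ) (hS : IsUnit S.det) (ℓ : Fin n)
    (f : (Fin n → ℝ) → ℝ)
    (Hhat H : Matrix (Fin n) (Fin n) ℝ) (ab α : Fin n → ℝ) (α₀ : ℝ)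
    (hH1 : ∀ i, i ≠ ℓ → Hhat i ℓ =
      -f (x0 + mcol S i - mcol S ℓ) + f (x0 + mcol S i) + f (x0 - mcol S ℓ) - f x0)
    (hH1' : ∀ i, i ≠ ℓ → Hhat ℓ i = Hhat i ℓ)
    (hH2 : ∀ i, i ≠ ℓ → Hhat i i =
      f (x0 + (2 : ℝ) • mcol S i - mcol S ℓ) - 2 * f (x0 + mcol S i - mcol S ℓ)
        + f (x0 - mcol S ℓ))
    (hH3 : Hhat ℓ ℓ = f (x0 + mcol S ℓ) + f (x0 - mcol S ℓ) - 2 * f x0)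
    (hH4 : ∀ i j, i ≠ j → i ≠ ℓ → j ≠ ℓ → Hhat i j =
      f (x0 + mcol S i + mcol S j - mcol S ℓ) - f (x0 + mcol S i - mcol S ℓ)
        - f (x0 + mcol S j - mcol S ℓ) + f (x0 - mcol S ℓ))
    (hH : H = (Sᵀ)⁻¹ * Hhat * S⁻¹)
    (hab : ∀ i, ab i = f (x0 + mcol S i) - f x0 - (1 / 2) * Hhat i i
      - x0 ⬝ᵥ (H *ᵥ mcol S i))
    (hα : α = (Sᵀ)⁻¹ *ᵥ ab)
    (hα₀ : α₀ = f x0 - α ⬝ᵥ x0 - (1 / 2) * (x0 ⬝ᵥ (H *ᵥ x0))) :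
    ∀ y ∈ gshSet x0 S (Umat S (some ℓ)),
      α₀ + α ⬝ᵥ y + (1 / 2) * (y ⬝ᵥ (H *ᵥ y)) = f y := by
  have hHhat : Hhat.IsSymm := by
    ext i j
    rw [transpose_apply]
    by_cases hij : i = j
    · rw [hij]
    by_cases hi : i = ℓ
    · subst hi
      exact (hH1' j (Ne.symm hij)).symm
    by_cases hj : j = ℓ
    · subst hj
      exact hH1' i hij
    rw [hH4 i j hij hi hj, hH4 j i (Ne.symm hij) hj hi, add_right_comm x0 (mcol S j)]
    ring
  have hHs : H.IsSymm := by
    rw [hH, IsSymm, transpose_mul, transpose_mul, hHhat.eq, transpose_nonsing_inv,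
      transpose_nonsing_inv, transpose_transpose, Matrix.mul_assoc]
  have hB (i j) : mcol S i ⬝ᵥ (H *ᵥ mcol S j) = Hhat i j := by
    rw [hH, mcol_dotProduct_congruence_mulVec_mcol hS]
  have hA (i) : α ⬝ᵥ mcol S i = ab i := by
    rw [hα, inv_transpose_mulVec_dotProduct_mcol hS]
  have hC (i) : mcol S i ⬝ᵥ (H *ᵥ x0) = x0 ⬝ᵥ (H *ᵥ mcol S i) :=
    dotProduct_mulVec_comm_of_isSymm hHs _ _
  have q_zero : α₀ + α ⬝ᵥ x0 + (1 / 2) * (x0 ⬝ᵥ (H *ᵥ x0)) = f x0 := by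
    rw [hα₀]
    ring
  have q_add (i) : α₀ + α ⬝ᵥ (x0 + mcol S i)
      + (1 / 2) * ((x0 + mcol S i) ⬝ᵥ (H *ᵥ (x0 + mcol S i))) = f (x0 + mcol S i) := by
    simp only [mulVec_add, dotProduct_add, add_dotProduct, hA, hB, hC, hab, hα₀]
    ring
  have q_sub : α₀ + α ⬝ᵥ (x0 - mcol S ℓ)
      + (1 / 2) * ((x0 - mcol S ℓ) ⬝ᵥ (H *ᵥ (x0 - mcol S ℓ))) = f (x0 - mcol S ℓ) := by
    simp only [mulVec_sub, dotProduct_sub, sub_dotProduct, hA, hB, hC, hab, hα₀]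
    linarith
  have q_add_sub (i) (hi : i ≠ ℓ) : α₀ + α ⬝ᵥ (x0 + mcol S i - mcol S ℓ)
      + (1 / 2) * ((x0 + mcol S i - mcol S ℓ) ⬝ᵥ (H *ᵥ (x0 + mcol S i - mcol S ℓ)))
      = f (x0 + mcol S i - mcol S ℓ) := by
    simp only [mulVec_sub, dotProduct_sub, sub_dotProduct, mulVec_add, dotProduct_add,
      add_dotProduct, hA, hB, hC, hab, hα₀]
    linarith [hH1 i hi, hH1' i hi]
  have q_add_add_sub (i j) (hi : i ≠ ℓ) (hj : j ≠ ℓ) :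
      α₀ + α ⬝ᵥ (x0 + mcol S i + mcol S j - mcol S ℓ)
        + (1 / 2) * ((x0 + mcol S i + mcol S j - mcol S ℓ)
          ⬝ᵥ (H *ᵥ (x0 + mcol S i + mcol S j - mcol S ℓ)))
      = f (x0 + mcol S i + mcol S j - mcol S ℓ) := by
    have hD : Hhat i j = f (x0 + mcol S i + mcol S j - mcol S ℓ) - f (x0 + mcol S i - mcol S ℓ)
        - f (x0 + mcol S j - mcol S ℓ) + f (x0 - mcol S ℓ) := by
      by_cases hij : i = j
      · subst hij
        rw [hH2 i hi, two_smul, ← add_assoc]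
        ring
      · exact hH4 i j hij hi hj
    have hsymm : Hhat j i = Hhat i j := hHhat.apply i j
    simp only [mulVec_sub, dotProduct_sub, sub_dotProduct, mulVec_add, dotProduct_add,
      add_dotProduct, hA, hB, hC, hab, hα₀]
    linarith [hH1 i hi, hH1' i hi, hH1 j hj, hH1' j hj]
  rintro y (((rfl | ⟨i, rfl⟩) | ⟨j, rfl⟩) | ⟨⟨i, j⟩, rfl⟩)
  · exact q_zero
  · exact q_add i
  · dsimp only
    rw [mcol_Umat_some]
    split_ifs with hj
    · rw [← sub_eq_add_neg]
      exact q_sub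
    · rw [← add_sub_assoc]
      exact q_add_sub j hj
  · dsimp only
    rw [mcol_Umat_some]
    split_ifs with hj
    · rw [← sub_eq_add_neg]
      by_cases hi : i = ℓ
      · rw [hi, add_sub_cancel_right]
        exact q_zero
      · exact q_add_sub i hi
    · rw [← add_sub_assoc]
      by_cases hi : i = ℓ
      · rw [hi, add_right_comm x0, add_sub_cancel_right]
        exact q_add j
      · exact q_add_add_sub i j hi hj
end
end

section
/- Let x⁰ ∈ ℝⁿ, let S = [s¹ … sⁿ] ∈ ℝ^{n×n} be invertible, and let f : ℝⁿ → ℝ be defined on 𝒮(x⁰;S,U₀). Define the symmetric matrix Ĥ ∈ ℝ^{n×n} by Ĥ_{i,i} = f(x⁰+2s^i) − 2f(x⁰+s^i) + f(x⁰) for all i, and Ĥ_{i,j} = f(x⁰+s^i+s^j) − f(x⁰+s^i) − f(x⁰+s^j) + f(x⁰) for i ≠ j. Set H = S^{−ᵀ} Ĥ S^{−1}, ᾱ ∈ ℝⁿ with ᾱ_i = f(x⁰+s^i) − f(x⁰) − ½ Ĥ_{i,i} − (x⁰)ᵀ H s^i, α = S^{−ᵀ} ᾱ, and α₀ = f(x⁰)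 − αᵀ x⁰ − ½ (x⁰)ᵀ H x⁰. Then the quadratic Q(x) = α₀ + αᵀ x + ½ xᵀ H x interpolates f on the whole sample set: Q(y) = f(y) for every y ∈ 𝒮(x⁰;S,U₀) = {x⁰} ∪ {x⁰+s^i : i} ∪ {x⁰+2s^i : i} ∪ {x⁰+s^i+s^j : i ≠ j}. -/
open Matrix

noncomputable section

theorem mcol_dotProduct_transpose_inv_mulVec {n : ℕ} {S : Matrix (Fin n) (Fin n) ℝ}
    (hS : IsUnit S.det) (a : Fin n → ℝ) (i : Fin n) :
    mcol S i ⬝ᵥ ((Sᵀ)⁻¹ *ᵥ a) = a i := by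
  have hT : IsUnit (Sᵀ).det := by rwa [det_transpose]
  change (Sᵀ *ᵥ ((Sᵀ)⁻¹ *ᵥ a)) i = a i
  rw [mulVec_mulVec, mul_nonsing_inv _ hT, one_mulVec]

theorem inv_mulVec_mcol {n : ℕ} {S : Matrix (Fin n) (Fin n) ℝ}
    (hS : IsUnit S.det) (j : Fin n) : S⁻¹ *ᵥ mcol S j = Pi.single j 1 := by
  have h : mcol S j = S *ᵥ Pi.single j 1 := by
    rw [mulVec_single_one]
    rfl
  rw [h, mulVec_mulVec, nonsing_inv_mul _ hS, one_mulVec]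

theorem mcol_dotProduct_congr_mulVec_mcol {n : ℕ} {S : Matrix (Fin n) (Fin n) ℝ}
    (hS : IsUnit S.det) (A : Matrix (Fin n) (Fin n) ℝ) (i j : Fin n) :
    mcol S i ⬝ᵥ (((Sᵀ)⁻¹ * A * S⁻¹) *ᵥ mcol S j) = A i j := by
  rw [← mulVec_mulVec, inv_mulVec_mcol hS, ← mulVec_mulVec,
    mcol_dotProduct_transpose_inv_mulVec hS, mulVec_single_one]
  rfl

theorem quad_interp_coeffs_U0 {n : ℕ} (x0 : Fin n → ℝ)
    (S : Matrix (Fin n) (Fin n) ℝ) (hS : IsUnit S.det)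
    (f : (Fin n → ℝ) → ℝ)
    (Hhat H : Matrix (Fin n) (Fin n) ℝ) (ab α : Fin n → ℝ) (α₀ : ℝ)
    (hH2 : ∀ i, Hhat i i = f (x0 + (2 : ℝ) • mcol S i) - 2 * f (x0 + mcol S i) + f x0)
    (hH4 : ∀ i j, i ≠ j → Hhat i j =
      f (x0 + mcol S i + mcol S j) - f (x0 + mcol S i) - f (x0 + mcol S j) + f x0)
    (hH : H = (Sᵀ)⁻¹ * Hhat * S⁻¹)
    (hab : ∀ i, ab i = f (x0 + mcol S i) - f x0 - (1 / 2) * Hhat i i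
      - x0 ⬝ᵥ (H *ᵥ mcol S i))
    (hα : α = (Sᵀ)⁻¹ *ᵥ ab)
    (hα₀ : α₀ = f x0 - α ⬝ᵥ x0 - (1 / 2) * (x0 ⬝ᵥ (H *ᵥ x0))) :
    ∀ y ∈ gshSet x0 S (Umat S none),
      α₀ + α ⬝ᵥ y + (1 / 2) * (y ⬝ᵥ (H *ᵥ y)) = f y := by
  have hsymm : Hhatᵀ = Hhat := by
    ext i j
    rw [transpose_apply]
    rcases eq_or_ne i j with rfl | h
    · rfl
    · rw [hH4 i j h, hH4 j i h.symm, add_right_comm x0]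
      ring
  have hHsymm : Hᵀ = H := by
    rw [hH, transpose_mul, transpose_mul, hsymm, transpose_nonsing_inv, transpose_nonsing_inv,
      transpose_transpose, Matrix.mul_assoc]
  have hcomm : ∀ u v : Fin n → ℝ, u ⬝ᵥ (H *ᵥ v) = v ⬝ᵥ (H *ᵥ u) := fun u v => by
    rw [dotProduct_mulVec, ← mulVec_transpose, hHsymm, dotProduct_comm]
  have hαS : ∀ i, α ⬝ᵥ mcol S i = ab i := fun i => by
    rw [hα, dotProduct_comm, mcol_dotProduct_transpose_inv_mulVec hS]
  have hHS : ∀ i j, mcol S i ⬝ᵥ (H *ᵥ mcol S j) = Hhat i j := fun i j => by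
    rw [hH, mcol_dotProduct_congr_mulVec_mcol hS]
  have single : ∀ i, α₀ + α ⬝ᵥ (x0 + mcol S i)
      + (1 / 2) * ((x0 + mcol S i) ⬝ᵥ (H *ᵥ (x0 + mcol S i))) = f (x0 + mcol S i) := fun i => by
    simp only [mulVec_add, dotProduct_add, add_dotProduct, hαS, hHS, hcomm (mcol S i) x0]
    linarith [hab i]
  rintro y (((rfl | ⟨i, rfl⟩) | ⟨i, rfl⟩) | ⟨⟨i, j⟩, rfl⟩)
  · linarith
  · exact single i
  · exact single i
  · simp only [Umat]
    have hf : Hhat i j = f (x0 + mcol S i + mcol S j) - f (x0 + mcol S i)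
        - f (x0 + mcol S j) + f x0 := by
      rcases eq_or_ne i j with rfl | h
      · rw [hH2, two_smul, ← add_assoc]
        ring
      · exact hH4 i j h
    simp only [mulVec_add, dotProduct_add, add_dotProduct, hαS, hHS, hcomm (mcol S i) x0,
      hcomm (mcol S j) x0]
    have hji : Hhat j i = Hhat i j := congrFun (congrFun hsymm i) j
    linarith [hab i, hab j]
end
end
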